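/- Let n ≥ 2 and let G be a group of permutations of ℚ^n properly containing AGL_n(ℚ). Suppose G preserves a limit of Jordan sets on ℚ^n, and suppose that for some m ∈ ℕ, G is m-transitive but not (m+1)-transitive on ℚ^n. Then there exists a Steiner m-system on ℚ^n preserved by G. -/

import Mathlib

/-- `σ` is an element of `AGL_n(ℚ)`: a permutation of `ℚ^n` of the form
`x ↦ T x + b` with `T` an invertible `ℚ`-linear map and `b ∈ ℚ^n`. -/
def IsAGL (n : ℕ) (σ : Equiv.Perm (Fin n → ℚ)) : Prop :=
  ∃ T : (Fin n → ℚ) ≃ₗ[ℚ] (Fin n → ℚ), ∃ b : Fin n → ℚ, ∀ x, σ x = T x + b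

/-- `(X, B)` is a Steiner `k`-system: all blocks have the same cardinality,
every block has more than `k` elements, there is more than one block, and any
`k` pairwise distinct points lie in a unique block. -/
def IsSteinerSystem {X : Type*} (k : ℕ) (B : Set (Set X)) : Prop :=
  (∀ b₁ ∈ B, ∀ b₂ ∈ B, Cardinal.mk b₁ = Cardinal.mk b₂) ∧
  (∀ b ∈ B, (k : Cardinal) < Cardinal.mk b) ∧
  (∃ b₁ ∈ B, ∃ b₂ ∈ B, b₁ ≠ b₂) ∧
  (∀ f : Fin k → X, Function.Injective f → ∃! b, b ∈ B ∧ ∀ i, f i ∈ b)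

/-- A subgroup `G` of the permutations of `X` is `k`-transitive. -/
def IsKTransitive {X : Type*} (G : Subgroup (Equiv.Perm X)) (k : ℕ) : Prop :=
  ∀ f g : Fin k → X, Function.Injective f → Function.Injective g →
    ∃ σ ∈ G, ∀ i, σ (f i) = g i

/-- `P` is a limit of Jordan sets for `G`: an increasing family of proper subsets covering `X`,
eventually permuted by each element of `G`, whose complements are orbits of the corresponding
pointwise stabilizers. -/
structure IsJordanLimit {X J : Type*} [LinearOrder J] (G : Subgroup (Equiv.Perm X))
    (P : J → Set X) : Prop where
  nonempty : Nonempty J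
  exists_gt : ∀ i : J, ∃ j, i < j
  mono : Monotone P
  exists_notMem : ∀ i, ∃ z, z ∉ P i
  cover : ∀ x, ∃ i, x ∈ P i
  move : ∀ g ∈ G, ∃ i₀ : J, ∀ i, i₀ < i → ∃ j, (g : Equiv.Perm X) '' P i = P j
  jordan : ∀ i, ∀ x ∉ P i, ∀ y ∉ P i, ∃ σ ∈ G, σ x = y ∧ ∀ z ∈ P i, σ z = z

/-- The complement of the orbit of the pointwise stabilizer of `S` that eventually contains the
sets `(P i)ᶜ`. -/
def jordanClosure {X J : Type*} (G : Subgroup (Equiv.Perm X)) (P : J → Set X) (S : Set X) :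
    Set X :=
  {x | ¬ ∃ σ ∈ G, (∀ s ∈ S, σ s = s) ∧ ∃ i, S ⊆ P i ∧ σ x ∉ P i}

section Closure

variable {X J : Type*} {G : Subgroup (Equiv.Perm X)} {P : J → Set X}

theorem notMem_jordanClosure {S : Set X} {x : X} : x ∉ jordanClosure G P S ↔
    ∃ σ ∈ G, (∀ s ∈ S, σ s = s) ∧ ∃ i, S ⊆ P i ∧ σ x ∉ P i := by
  exact not_not

theorem subset_jordanClosure (S : Set X) : S ⊆ jordanClosure G P S := by
  rintro s hs ⟨σ, -, hfix, i, hi, hx⟩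
  rw [hfix s hs] at hx
  exact hx (hi hs)

theorem jordanClosure_mono {S T : Set X} (h : S ⊆ T) :
    jordanClosure G P S ⊆ jordanClosure G P T := by
  rintro x hx ⟨σ, hσ, hfix, i, hi, hxi⟩
  exact hx ⟨σ, hσ, fun s hs => hfix s (h hs), i, h.trans hi, hxi⟩

theorem jordanClosure_subset_of_subset {S : Set X} {i : J} (h : S ⊆ P i) :
    jordanClosure G P S ⊆ P i := by
  intro x hx
  by_contra hxi
  exact hx ⟨1, G.one_mem, fun _ _ => rfl, i, h, hxi⟩

theorem apply_mem_jordanClosure_of_fix {S : Set X} {σ : Equiv.Perm X} (hσ : σ ∈ G)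
    (hfix : ∀ s ∈ S, σ s = s) {x : X} (hx : x ∈ jordanClosure G P S) :
    σ x ∈ jordanClosure G P S := by
  rintro ⟨τ, hτ, hτfix, i, hi, hxi⟩
  exact hx ⟨τ * σ, G.mul_mem hτ hσ,
    fun s hs => by rw [Equiv.Perm.mul_apply, hfix s hs, hτfix s hs], i, hi, hxi⟩

variable [LinearOrder J]

namespace IsJordanLimit

theorem exists_subset_of_finset (h : IsJordanLimit G P) (A : Finset X) :
    ∃ i, (A : Set X) ⊆ P i := by
  classical
  induction A using Finset.induction_on with
  | empty => exact ⟨h.nonempty.some, by simp⟩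
  | insert a A _ ih =>
    obtain ⟨i, hi⟩ := ih
    obtain ⟨j, hj⟩ := h.cover a
    refine ⟨max i j, ?_⟩
    rw [Finset.coe_insert, Set.insert_subset_iff]
    exact ⟨h.mono (le_max_right i j) hj, hi.trans (h.mono (le_max_left i j))⟩

theorem exists_notMem_jordanClosure (h : IsJordanLimit G P) (A : Finset X) :
    ∃ x, x ∉ jordanClosure G P (A : Set X) := by
  obtain ⟨i, hi⟩ := h.exists_subset_of_finset A
  obtain ⟨z, hz⟩ := h.exists_notMem i
  exact ⟨z, fun hc => hz (jordanClosure_subset_of_subset hi hc)⟩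

theorem exists_moves_out (h : IsJordanLimit G P) {S : Set X} {x : X}
    (hx : x ∉ jordanClosure G P S) (k : J) :
    ∃ σ ∈ G, (∀ s ∈ S, σ s = s) ∧ ∃ i, k < i ∧ S ⊆ P i ∧ σ x ∉ P i := by
  obtain ⟨σ, hσ, hfix, i, hi, hxi⟩ := notMem_jordanClosure.1 hx
  obtain ⟨j, hj⟩ := h.exists_gt (max i k)
  have hij : i ≤ j := (le_max_left i k).trans hj.le
  obtain ⟨z, hz⟩ := h.exists_notMem j
  obtain ⟨τ, hτ, hτx, hτfix⟩ := h.jordan i (σ x) hxi z fun hc => hz (h.mono hij hc)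
  refine ⟨τ * σ, G.mul_mem hτ hσ, fun s hs => ?_, j, (le_max_right i k).trans_lt hj,
    hi.trans (h.mono hij), ?_⟩
  · rw [Equiv.Perm.mul_apply, hfix s hs, hτfix s (hi hs)]
  · rwa [Equiv.Perm.mul_apply, hτx]

theorem exists_fix_apply_eq (h : IsJordanLimit G P) {S : Set X} {x y : X}
    (hx : x ∉ jordanClosure G P S)
    (hy : y ∉ jordanClosure G P S) : ∃ σ ∈ G, (∀ s ∈ S, σ s = s) ∧ σ x = y := by
  obtain ⟨σ, hσ, hfix, i, hi, hxi⟩ := notMem_jordanClosure.1 hx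
  obtain ⟨τ, hτ, hτfix, j, hij, -, hyj⟩ := h.exists_moves_out hy i
  obtain ⟨ρ, hρ, hρx, hρfix⟩ :=
    h.jordan i (σ x) hxi (τ y) fun hc => hyj (h.mono hij.le hc)
  refine ⟨τ⁻¹ * (ρ * σ), G.mul_mem (G.inv_mem hτ) (G.mul_mem hρ hσ), fun s hs => ?_, ?_⟩
  · rw [Equiv.Perm.mul_apply, Equiv.Perm.mul_apply, hfix s hs, hρfix s (hi hs),
      Equiv.Perm.inv_eq_iff_eq, hτfix s hs]
  · rw [Equiv.Perm.mul_apply, Equiv.Perm.mul_apply, hρx, Equiv.Perm.inv_eq_iff_eq]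

theorem apply_notMem_jordanClosure_image (h : IsJordanLimit G P) {g : Equiv.Perm X}
    (hg : g ∈ G) {S : Set X} {x : X}
    (hx : x ∉ jordanClosure G P S) : g x ∉ jordanClosure G P (g '' S) := by
  obtain ⟨i₀, hi₀⟩ := h.move g hg
  obtain ⟨σ, hσ, hfix, i, hi, hSi, hxi⟩ := h.exists_moves_out hx i₀
  obtain ⟨j, hj⟩ := hi₀ i hi
  refine notMem_jordanClosure.2
    ⟨g * σ * g⁻¹, G.mul_mem (G.mul_mem hg hσ) (G.inv_mem hg), ?_, j, ?_, ?_⟩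
  · rintro _ ⟨s, hs, rfl⟩
    simp [hfix s hs]
  · rw [← hj]
    exact Set.image_mono hSi
  · rw [← hj]
    simpa using hxi

theorem image_jordanClosure (h : IsJordanLimit G P) {g : Equiv.Perm X} (hg : g ∈ G) (S : Set X) :
    g '' jordanClosure G P S = jordanClosure G P (g '' S) := by
  ext y
  obtain ⟨x, rfl⟩ := g.surjective y
  rw [g.injective.mem_set_image]
  constructor
  · intro hx
    by_contra hc
    have := h.apply_notMem_jordanClosure_image (G.inv_mem hg) hc
    rw [← Set.image_comp] at this
    simp at this
    exact this hx
  · intro hx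
    by_contra hc
    exact h.apply_notMem_jordanClosure_image hg hc hx

theorem jordanClosure_idem (h : IsJordanLimit G P) (S : Set X) :
    jordanClosure G P (jordanClosure G P S) = jordanClosure G P S := by
  refine subset_antisymm (fun x hx => ?_) (subset_jordanClosure _)
  by_contra hxS
  refine hx ?_
  obtain ⟨σ, hσ, hfix, i, hi, hxi⟩ := notMem_jordanClosure.1 hxS
  have hcl : jordanClosure G P S ⊆ P i := jordanClosure_subset_of_subset hi
  obtain ⟨i₀, hi₀⟩ := h.move σ⁻¹ (G.inv_mem hσ)
  obtain ⟨k, hk⟩ := h.exists_gt (max i i₀)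
  obtain ⟨j, hj⟩ := hi₀ k ((le_max_right _ _).trans_lt hk)
  obtain ⟨z, hz⟩ := h.exists_notMem (max i j)
  have hσz : σ z ∉ P i := fun hc => hz <| h.mono (le_max_right i j) <| hj ▸
    ⟨σ z, h.mono ((le_max_left _ _).trans hk.le) hc, by simp⟩
  obtain ⟨τ, hτ, hτx, hτfix⟩ := h.jordan i (σ x) hxi (σ z) hσz
  refine ⟨σ⁻¹ * (τ * σ), G.mul_mem (G.inv_mem hσ) (G.mul_mem hτ hσ), fun s hs => ?_, i, hcl, ?_⟩
  · rw [Equiv.Perm.mul_apply, Equiv.Perm.mul_apply,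
      hτfix _ (hcl (apply_mem_jordanClosure_of_fix hσ hfix hs)), Equiv.Perm.inv_eq_iff_eq]
  · rw [Equiv.Perm.mul_apply, Equiv.Perm.mul_apply, hτx, Equiv.Perm.inv_eq_iff_eq.2 rfl]
    exact fun hc => hz (h.mono (le_max_left i j) hc)

theorem jordanClosure_subset_jordanClosure (h : IsJordanLimit G P) {S T : Set X}
    (hST : S ⊆ jordanClosure G P T) :
    jordanClosure G P S ⊆ jordanClosure G P T :=
  (jordanClosure_mono hST).trans (h.jordanClosure_idem T).subset

end IsJordanLimit

end Closure

section Transitivity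

variable {X : Type*} {G : Subgroup (Equiv.Perm X)}

theorem exists_injective_range_eq {k : ℕ} {A : Finset X} (hA : A.card = k) :
    ∃ f : Fin k → X, Function.Injective f ∧ Set.range f = A := by
  refine ⟨fun i => (A.equivFinOfCardEq hA).symm i,
    Subtype.val_injective.comp (Equiv.injective _), ?_⟩
  ext x
  constructor
  · rintro ⟨i, rfl⟩
    exact ((A.equivFinOfCardEq hA).symm i).2
  · intro hx
    exact ⟨A.equivFinOfCardEq hA ⟨x, hx⟩, by simp⟩

theorem IsKTransitive.exists_image_eq {k : ℕ} (htrans : IsKTransitive G k) {A B : Finset X}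
    (hA : A.card = k) (hB : B.card = k) : ∃ g ∈ G, (g : Equiv.Perm X) '' A = B := by
  obtain ⟨f, hf, hfA⟩ := exists_injective_range_eq hA
  obtain ⟨f', hf', hfB⟩ := exists_injective_range_eq hB
  obtain ⟨g, hg, hgf⟩ := htrans f f' hf hf'
  refine ⟨g, hg, ?_⟩
  rw [← hfA, ← hfB, ← Set.range_comp]
  exact congrArg Set.range (funext hgf)

theorem IsKTransitive.exists_image_eq_apply_eq {k : ℕ} (htrans : IsKTransitive G (k + 1))
    {A B : Finset X} (hA : A.card = k) (hB : B.card = k) {a b : X} (ha : a ∉ A) (hb : b ∉ B) :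
    ∃ g ∈ G, (g : Equiv.Perm X) '' A = B ∧ g a = b := by
  obtain ⟨f, hf, hfA⟩ := exists_injective_range_eq hA
  obtain ⟨f', hf', hfB⟩ := exists_injective_range_eq hB
  obtain ⟨g, hg, hgf⟩ := htrans (Fin.cons a f) (Fin.cons b f')
    (Fin.cons_injective_iff.2 ⟨by rw [hfA]; simpa using ha, hf⟩)
    (Fin.cons_injective_iff.2 ⟨by rw [hfB]; simpa using hb, hf'⟩)
  refine ⟨g, hg, ?_, by simpa using hgf 0⟩
  rw [← hfA, ← hfB, ← Set.range_comp]
  exact congrArg Set.range (funext fun i => by simpa using hgf i.succ)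

end Transitivity

namespace IsJordanLimit

variable {X J : Type*} [LinearOrder J] {G : Subgroup (Equiv.Perm X)} {P : J → Set X}

/-- If some two points are incomparable over a set of size `k`, then the closure has the exchange
property over sets of size `k`. -/
theorem exchange (h : IsJordanLimit G P) {k : ℕ} (htrans : IsKTransitive G (k + 1))
    {A : Finset X} (hA : A.card = k) {c e : X} (hcA : c ∉ A)
    (hc : c ∉ jordanClosure G P (insert e (A : Set X)))
    (he : e ∉ jordanClosure G P (insert c (A : Set X)))
    {B : Finset X} (hB : B.card = k) {x y : X} (hxB : x ∉ B)
    (hx : x ∈ jordanClosure G P (insert y (B : Set X))) :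
    y ∈ jordanClosure G P (insert x (B : Set X)) := by
  by_contra hy
  obtain ⟨g, hg, hgA, hgc⟩ := htrans.exists_image_eq_apply_eq hA hB hcA hxB
  have hc' := h.apply_notMem_jordanClosure_image hg hc
  have he' := h.apply_notMem_jordanClosure_image hg he
  rw [Set.image_insert_eq, hgA, hgc] at hc' he'
  obtain ⟨σ, hσ, hfix, hσy⟩ := h.exists_fix_apply_eq hy he'
  have := Set.mem_image_of_mem σ hx
  rw [h.image_jordanClosure hσ, Set.image_insert_eq, hσy, hfix x (Set.mem_insert _ _)] at this
  have hσB : σ '' (B : Set X) = B := by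
    rw [Set.image_congr fun b hb => hfix b (Set.mem_insert_of_mem _ hb), Set.image_id']
  rw [hσB] at this
  exact hc' this

theorem jordanClosure_eq_of_subset (h : IsJordanLimit G P) {k : ℕ}
    (hexch : ∀ (B : Finset X) (x y : X), B.card = k → x ∉ B →
      x ∈ jordanClosure G P (insert y (B : Set X)) →
      y ∈ jordanClosure G P (insert x (B : Set X)))
    {A B : Finset X} (hA : A.card = k + 1) (hB : B.card = k + 1)
    (hBA : (B : Set X) ⊆ jordanClosure G P A) :
    jordanClosure G P (B : Set X) = jordanClosure G P A := by
  classical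
  induction hN : (A \ B).card generalizing A with
  | zero =>
    have hAB : A ⊆ B := Finset.sdiff_eq_empty_iff_subset.1 (Finset.card_eq_zero.1 hN)
    rw [Finset.eq_of_subset_of_card_le hAB (by omega)]
  | succ N ih =>
    obtain ⟨d, hd⟩ := Finset.card_pos.1 (by omega : 0 < (A \ B).card)
    have hBA' : (B \ A).card = (A \ B).card := Finset.card_sdiff_comm (by omega)
    obtain ⟨c, hc⟩ := Finset.card_pos.1 (by omega : 0 < (B \ A).card)
    rw [Finset.mem_sdiff] at hd hc
    have hAd : insert d ((A.erase d : Finset X) : Set X) = A := by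
      rw [← Finset.coe_insert, Finset.insert_erase hd.1]
    have hcE : c ∉ A.erase d := fun hcc => hc.2 (Finset.mem_of_mem_erase hcc)
    have hdc := hexch (A.erase d) c d (by rw [Finset.card_erase_of_mem hd.1]; omega) hcE
      (hAd ▸ hBA hc.1)
    have hcl : jordanClosure G P ((insert c (A.erase d) : Finset X) : Set X) =
        jordanClosure G P A := by
      refine subset_antisymm (h.jordanClosure_subset_jordanClosure ?_)
        (h.jordanClosure_subset_jordanClosure ?_)
      · rw [Finset.coe_insert, Set.insert_subset_iff]
        exact ⟨hBA hc.1, (Finset.coe_subset.2 (Finset.erase_subset d A)).trans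
          (subset_jordanClosure _)⟩
      · rw [← hAd, Set.insert_subset_iff, Finset.coe_insert]
        exact ⟨hdc, (Set.subset_insert _ _).trans (subset_jordanClosure _)⟩
    rw [← hcl]
    refine ih ?_ (hcl ▸ hBA) ?_
    · rw [Finset.card_insert_of_notMem hcE, Finset.card_erase_of_mem hd.1]; omega
    · rw [Finset.insert_sdiff_of_mem _ hc.1, Finset.erase_sdiff_comm,
        Finset.card_erase_of_mem (Finset.mem_sdiff.2 hd)]
      omega

theorem exists_mem_jordanClosure_notMem (h : IsJordanLimit G P) {m : ℕ}
    (htrans : IsKTransitive G m) (hnottrans : ¬ IsKTransitive G (m + 1))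
    {A : Finset X} (hA : A.card = m) : ∃ y ∈ jordanClosure G P (A : Set X), y ∉ A := by
  classical
  by_contra! hcl
  refine hnottrans fun f g hf hg => ?_
  have hf' : Function.Injective fun i : Fin m => f i.castSucc :=
    hf.comp (Fin.castSucc_injective m)
  have hg' : Function.Injective fun i : Fin m => g i.castSucc :=
    hg.comp (Fin.castSucc_injective m)
  obtain ⟨σ, hσ, hσf⟩ := htrans _ _ hf' hg'
  obtain ⟨τ, hτ, hτA⟩ := htrans.exists_image_eq hA
    (B := Finset.univ.image fun i : Fin m => g i.castSucc)
    (by rw [Finset.card_image_of_injective _ hg', Finset.card_fin])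
  have hB : ∀ y, (∀ i : Fin m, g i.castSucc ≠ y) →
      y ∉ jordanClosure G P ((Finset.univ.image fun i : Fin m => g i.castSucc : Finset X)) := by
    intro y hy hyc
    rw [← hτA, ← h.image_jordanClosure hτ] at hyc
    obtain ⟨z, hz, rfl⟩ := hyc
    have : τ z ∈ τ '' (A : Set X) := Set.mem_image_of_mem _ (hcl z hz)
    rw [hτA] at this
    simp only [Finset.coe_image, Finset.coe_univ, Set.image_univ, Set.mem_range] at this
    exact this.elim hy
  obtain ⟨ρ, hρ, hfix, hρx⟩ := h.exists_fix_apply_eq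
    (hB (σ (f (Fin.last m))) fun i hi => by
      rw [← hσf i] at hi
      exact (Fin.castSucc_lt_last i).ne (hf (σ.injective hi)))
    (hB (g (Fin.last m)) fun i hi => (Fin.castSucc_lt_last i).ne (hg hi))
  refine ⟨ρ * σ, G.mul_mem hρ hσ, fun i => ?_⟩
  refine Fin.lastCases ?_ (fun i => ?_) i
  · exact hρx
  · rw [Equiv.Perm.mul_apply, hσf i]
    exact hfix _ (by simp)

theorem exists_isSteinerSystem [Infinite X] (h : IsJordanLimit G P) {k : ℕ}
    (htrans : IsKTransitive G (k + 1)) (hnottrans : ¬ IsKTransitive G (k + 1 + 1))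
    (hexch : ∀ (B : Finset X) (x y : X), B.card = k → x ∉ B →
      x ∈ jordanClosure G P (insert y (B : Set X)) →
      y ∈ jordanClosure G P (insert x (B : Set X))) :
    ∃ B : Set (Set X), IsSteinerSystem (k + 1) B ∧
      ∀ σ ∈ G, ∀ b ∈ B, (σ : Equiv.Perm X) '' b ∈ B := by
  classical
  refine ⟨{b | ∃ A : Finset X, A.card = k + 1 ∧ jordanClosure G P (A : Set X) = b},
    ⟨?_, ?_, ?_, ?_⟩, ?_⟩
  · rintro _ ⟨A, hA, rfl⟩ _ ⟨B, hB, rfl⟩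
    obtain ⟨g, hg, hgA⟩ := htrans.exists_image_eq hA hB
    rw [← hgA, ← h.image_jordanClosure hg, Cardinal.mk_image_eq g.injective]
  · rintro _ ⟨A, hA, rfl⟩
    obtain ⟨y, hy, hyA⟩ := h.exists_mem_jordanClosure_notMem htrans hnottrans hA
    have hsub : ((insert y A : Finset X) : Set X) ⊆ jordanClosure G P A := by
      rw [Finset.coe_insert, Set.insert_subset_iff]
      exact ⟨hy, subset_jordanClosure _⟩
    have hcard : Cardinal.mk ((insert y A : Finset X) : Set X) = ((k + 1 + 1 : ℕ) : Cardinal) := by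
      rw [← hA, ← Finset.card_insert_of_notMem hyA]
      exact Cardinal.mk_coe_finset
    have hle := Cardinal.mk_le_mk_of_subset hsub
    rw [hcard] at hle
    exact (Nat.cast_lt.2 (Nat.lt_succ_self _)).trans_le hle
  · obtain ⟨A, hA⟩ := Infinite.exists_subset_card_eq X (k + 1)
    obtain ⟨x, hx⟩ := h.exists_notMem_jordanClosure A
    obtain ⟨B, hB, hBk⟩ := Infinite.exists_superset_card_eq {x} (k + 1) (by simp)
    refine ⟨_, ⟨A, hA, rfl⟩, _, ⟨B, hBk, rfl⟩, fun hAB => hx ?_⟩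
    rw [hAB]
    exact subset_jordanClosure _ (hB (Finset.mem_singleton_self x))
  · intro f hf
    have hcard : (Finset.univ.image f).card = k + 1 := by
      rw [Finset.card_image_of_injective _ hf, Finset.card_fin]
    refine ⟨_, ⟨⟨Finset.univ.image f, hcard, rfl⟩,
      fun i => subset_jordanClosure _ (by simp)⟩, ?_⟩
    rintro _ ⟨⟨A, hA, rfl⟩, hfA⟩
    refine (h.jordanClosure_eq_of_subset hexch hA hcard ?_).symm
    simpa [Set.range_subset_iff] using hfA
  · rintro σ hσ _ ⟨A, hA, rfl⟩
    exact ⟨A.map σ.toEmbedding, by simpa using hA, by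
      rw [h.image_jordanClosure hσ, Finset.coe_map, Equiv.coe_toEmbedding]⟩

end IsJordanLimit

section Affine

variable {n : ℕ}

/-- The affine dilation or transvection `y ↦ y + (y j - c) • w`. -/
def coordShear (j : Fin n) (c : ℚ) (w : Fin n → ℚ) (hw : 1 + w j ≠ 0) :
    Equiv.Perm (Fin n → ℚ) where
  toFun y := y + (y j - c) • w
  invFun y := y - ((y j - c) / (1 + w j)) • w
  left_inv y := by
    ext i
    simp only [Pi.add_apply, Pi.sub_apply, Pi.smul_apply, smul_eq_mul]
    field_simp
    ring
  right_inv y := by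
    ext i
    simp only [Pi.add_apply, Pi.sub_apply, Pi.smul_apply, smul_eq_mul]
    field_simp
    ring

theorem coordShear_apply {j : Fin n} {c : ℚ} {w : Fin n → ℚ} (hw : 1 + w j ≠ 0)
    (y : Fin n → ℚ) : coordShear j c w hw y = y + (y j - c) • w :=
  rfl

theorem coordShear_apply_of_eq {j : Fin n} {c : ℚ} {w : Fin n → ℚ} (hw : 1 + w j ≠ 0)
    {y : Fin n → ℚ} (hy : y j = c) : coordShear j c w hw y = y := by
  simp [coordShear_apply, hy]

theorem isAGL_coordShear {j : Fin n} {c : ℚ} {w : Fin n → ℚ} (hw : 1 + w j ≠ 0) :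
    IsAGL n (coordShear j c w hw) := by
  refine ⟨LinearEquiv.ofBijective
    (LinearMap.id + (LinearMap.proj j : (Fin n → ℚ) →ₗ[ℚ] ℚ).smulRight w) ?_, -c • w, fun y => ?_⟩
  · convert (coordShear j 0 w hw).bijective using 1
    ext y i
    simp [coordShear_apply]
  · ext i
    simp [coordShear_apply]
    ring

theorem isAGL_addRight (v : Fin n → ℚ) : IsAGL n (Equiv.addRight v) :=
  ⟨LinearEquiv.refl ℚ _, v, fun _ => rfl⟩

variable {J : Type*} [LinearOrder J] {G : Subgroup (Equiv.Perm (Fin n → ℚ))}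
  {P : J → Set (Fin n → ℚ)}

theorem IsJordanLimit.jordanClosure_subset_level (h : IsJordanLimit G P)
    (hsub : ∀ σ, IsAGL n σ → σ ∈ G) {A : Finset (Fin n → ℚ)} {j : Fin n} {c : ℚ}
    (hA : ∀ a ∈ A, a j = c) {x : Fin n → ℚ} (hx : x ∈ jordanClosure G P (A : Set (Fin n → ℚ))) :
    x j = c := by
  by_contra hxj
  have hxj' : x j - c ≠ 0 := sub_ne_zero.2 hxj
  obtain ⟨i, hi⟩ := h.exists_subset_of_finset A
  obtain ⟨z, hzj, hzi⟩ : ∃ z : Fin n → ℚ, z j ≠ c ∧ z ∉ P i := by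
    by_contra! hall
    obtain ⟨i₀, hi₀⟩ := h.move _ (hsub _ (isAGL_addRight (Pi.single j (1 : ℚ))))
    obtain ⟨l, hl⟩ := h.exists_gt (max i i₀)
    have hil : i ≤ l := (le_max_left _ _).trans hl.le
    obtain ⟨r, hr⟩ := hi₀ l ((le_max_right _ _).trans_lt hl)
    obtain ⟨z, hz⟩ := h.exists_notMem (max l r)
    have hzj : z j = c := by
      by_contra hc
      exact hz (h.mono (hil.trans (le_max_left _ _)) (hall z hc))
    refine hz (h.mono (le_max_right l r) (hr ▸ ⟨z - Pi.single j 1, h.mono hil (hall _ ?_), ?_⟩))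
    · simp [hzj]
    · simp
  have hzj' : z j - c ≠ 0 := sub_ne_zero.2 hzj
  have hw : 1 + ((x j - c)⁻¹ • (z - x)) j ≠ 0 := by
    have : 1 + ((x j - c)⁻¹ • (z - x)) j = (z j - c) / (x j - c) := by
      simp only [Pi.smul_apply, Pi.sub_apply, smul_eq_mul]
      field_simp
      ring
    rw [this]
    exact div_ne_zero hzj' hxj'
  refine hx ⟨coordShear j c _ hw, hsub _ (isAGL_coordShear hw),
    fun a ha => coordShear_apply_of_eq hw (hA a ha), i, hi, ?_⟩
  rwa [coordShear_apply, smul_inv_smul₀ hxj', add_sub_cancel]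

/-- If points are pairwise comparable over sets of size `k`, then a closed set that contains `k`
points of a level set and a point off it contains this level set and a further parallel one. -/
theorem IsJordanLimit.level_subset (h : IsJordanLimit G P)
    (hsub : ∀ σ, IsAGL n σ → σ ∈ G) {k : ℕ}
    (htot : ∀ (A : Finset (Fin n → ℚ)) (c e : Fin n → ℚ), A.card = k → c ∉ A →
      c ∈ jordanClosure G P (insert e (A : Set (Fin n → ℚ))) ∨
      e ∈ jordanClosure G P (insert c (A : Set (Fin n → ℚ))))
    {D : Set (Fin n → ℚ)} (hD : jordanClosure G P D = D) {A : Finset (Fin n → ℚ)}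
    (hAk : A.card = k) (hAD : (A : Set (Fin n → ℚ)) ⊆ D) {j : Fin n} {c : ℚ}
    (hA : ∀ a ∈ A, a j = c) {e : Fin n → ℚ} (heD : e ∈ D) (hej : e j ≠ c) :
    (∀ x, x j = c → x ∈ D) ∧ ∀ x, x j = 2 * c - e j → x ∈ D := by
  classical
  have hcl : jordanClosure G P (insert e (A : Set (Fin n → ℚ))) ⊆ D := by
    rw [← hD]
    exact jordanClosure_mono (Set.insert_subset heD hAD)
  have hs : e j - c ≠ 0 := sub_ne_zero.2 hej
  refine ⟨fun x hx => ?_, fun x hx => ?_⟩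
  · by_cases hxA : x ∈ A
    · exact hAD hxA
    refine (htot A x e hAk hxA).elim (fun hxe => hcl hxe) fun hex => absurd ?_ hej
    rw [← Finset.coe_insert] at hex
    refine h.jordanClosure_subset_level hsub (fun a ha => ?_) hex
    rcases Finset.mem_insert.1 ha with rfl | ha
    · exact hx
    · exact hA a ha
  · have hxA : x ∉ A := fun hxA => hs (by linarith [hA x hxA])
    refine (htot A x e hAk hxA).elim (fun hxe => hcl hxe) fun hex => hcl ?_
    have hwj : ((e j - c)⁻¹ • (x - e)) j = -2 := by
      simp only [Pi.smul_apply, Pi.sub_apply, smul_eq_mul]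
      field_simp
      linarith
    have hw : 1 + ((e j - c)⁻¹ • (x - e)) j ≠ 0 := by
      rw [hwj]
      norm_num
    have hσe : coordShear j c _ hw e = x := by
      rw [coordShear_apply, smul_inv_smul₀ hs, add_sub_cancel]
    have hσx : coordShear j c _ hw x = e := by
      have : x j - c = -(e j - c) := by linarith
      rw [coordShear_apply, this, neg_smul, smul_inv_smul₀ hs]
      abel
    have hσA : coordShear j c _ hw '' (A : Set (Fin n → ℚ)) = A := by
      rw [Set.image_congr fun a ha => coordShear_apply_of_eq hw (hA a ha), Set.image_id']
    have := Set.mem_image_of_mem (coordShear j c _ hw) hex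
    rwa [h.image_jordanClosure (hsub _ (isAGL_coordShear hw)), Set.image_insert_eq, hσe, hσx,
      hσA] at this

theorem exists_finset_level {i j : Fin n} (hij : i ≠ j) (k : ℕ) (f : ℕ → ℚ)
    (hf : Function.Injective f) (c : ℚ) :
    ∃ A : Finset (Fin n → ℚ), A.card = k ∧ ∀ a ∈ A, a j = c ∧ ∃ l, a i = f l := by
  classical
  refine ⟨(Finset.range k).image fun l => Pi.single i (f l) + Pi.single j c, ?_, ?_⟩
  · rw [Finset.card_image_of_injective, Finset.card_range]
    intro a b hab
    have := congrFun hab i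
    simpa [hij, hf.eq_iff] using this
  · intro a ha
    obtain ⟨l, -, rfl⟩ := Finset.mem_image.1 ha
    exact ⟨by simp [hij.symm], l, by simp [hij]⟩

/-- Some two points are incomparable over some set of size `k`. -/
theorem IsJordanLimit.exists_incomparable (h : IsJordanLimit G P) (hn : 2 ≤ n)
    (hsub : ∀ σ, IsAGL n σ → σ ∈ G) (k : ℕ) :
    ∃ (A : Finset (Fin n → ℚ)) (c e : Fin n → ℚ), A.card = k ∧ c ∉ A ∧
      c ∉ jordanClosure G P (insert e (A : Set (Fin n → ℚ))) ∧
      e ∉ jordanClosure G P (insert c (A : Set (Fin n → ℚ))) := by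
  classical
  by_contra! hcon
  have htot : ∀ (A : Finset (Fin n → ℚ)) (c e : Fin n → ℚ), A.card = k → c ∉ A →
      c ∈ jordanClosure G P (insert e (A : Set (Fin n → ℚ))) ∨
      e ∈ jordanClosure G P (insert c (A : Set (Fin n → ℚ))) :=
    fun A c e hA hc => or_iff_not_imp_left.2 (hcon A c e hA hc)
  let p : Fin n := ⟨0, by omega⟩
  let q : Fin n := ⟨1, by omega⟩
  have hpq : p ≠ q := by simp [p, q]
  have hinj : Function.Injective fun l : ℕ => -(l : ℚ) :=
    neg_injective.comp Nat.cast_injective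
  obtain ⟨A, hAk, hA⟩ := exists_finset_level hpq.symm k _ hinj 0
  set D := jordanClosure G P (insert (Pi.single p (1 : ℚ)) (A : Set (Fin n → ℚ))) with hDdef
  have hD : jordanClosure G P D = D := h.jordanClosure_idem _
  have hstep : ∀ l : ℕ, (∀ x : Fin n → ℚ, x p = -(l : ℚ) → x ∈ D) ∧
      ∀ x : Fin n → ℚ, x p = -((l + 1 : ℕ) : ℚ) → x ∈ D := by
    intro l
    induction l with
    | zero =>
      have := h.level_subset hsub htot hD hAk
        ((Set.subset_insert _ _).trans (subset_jordanClosure _)) (fun a ha => (hA a ha).1)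
        (subset_jordanClosure _ (Set.mem_insert _ _)) (by simp)
      simpa using this
    | succ l ih =>
      refine ⟨ih.2, fun x hx => ?_⟩
      obtain ⟨A', hA'k, hA'⟩ := exists_finset_level hpq.symm k _ hinj (-((l + 1 : ℕ) : ℚ))
      have he : (Pi.single p (-(l : ℚ)) : Fin n → ℚ) p = -(l : ℚ) := by simp
      refine (h.level_subset hsub htot hD hA'k (fun a ha => ih.2 a (hA' a ha).1)
        (fun a ha => (hA' a ha).1) (ih.1 _ he) ?_).2 x ?_
      · rw [he]
        push_cast
        intro hc
        linarith
      · rw [hx, he]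
        push_cast
        ring
  obtain ⟨x, hx⟩ := h.exists_notMem_jordanClosure (insert (Pi.single p (1 : ℚ)) A)
  rw [Finset.coe_insert] at hx
  refine hx ?_
  obtain ⟨A', hA'k, hA'⟩ := exists_finset_level hpq k _ hinj (x q)
  refine (h.level_subset hsub htot hD hA'k (fun a ha => ?_) (fun a ha => (hA' a ha).1)
    ((hstep 0).1 (Pi.single q (x q + 1)) (by simp [hpq])) (by simp)).1 x rfl
  obtain ⟨l, hl⟩ := (hA' a ha).2
  exact (hstep l).1 a hl

end Affine

/-- If a group of permutations of `ℚ^n` (`n ≥ 2`) properly containing `AGL_n(ℚ)`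
preserves a limit of Jordan sets on `ℚ^n` (witnessed by a linear order `J` without
greatest element and a strictly increasing chain `P` of subsets covering `ℚ^n`,
eventually permuted by each `g ∈ G`, with each complement a Jordan set), and `G`
is `m`-transitive but not `(m+1)`-transitive, then `G` preserves a Steiner
`m`-system on `ℚ^n`. -/
theorem limit_of_jordan_sets_gives_steiner_system (n m : ℕ) (hn : 2 ≤ n)
    (G : Subgroup (Equiv.Perm (Fin n → ℚ)))
    (hsub : ∀ σ : Equiv.Perm (Fin n → ℚ), IsAGL n σ → σ ∈ G)
    (hproper : ∃ σ ∈ G, ¬ IsAGL n σ)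
    (J : Type*) [LinearOrder J] (hJ : ∀ i : J, ∃ j, i < j)
    (P : J → Set (Fin n → ℚ))
    (hchain : ∀ i j : J, i < j → P i ⊂ P j)
    (hunion : (⋃ i, P i) = Set.univ)
    (hmove : ∀ g ∈ G, ∃ i₀ : J, ∀ i, i₀ < i →
      ∃ j, (g : Equiv.Perm (Fin n → ℚ)) '' P i = P j)
    (hjordan : ∀ i : J, (2 : Cardinal) ≤ Cardinal.mk ((P i)ᶜ : Set (Fin n → ℚ)) ∧
      ∀ x ∈ (P i)ᶜ, ∀ y ∈ (P i)ᶜ,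
        ∃ σ ∈ G, σ x = y ∧ ∀ z ∈ P i, (σ : Equiv.Perm (Fin n → ℚ)) z = z)
    (htrans : IsKTransitive G m) (hnottrans : ¬ IsKTransitive G (m + 1)) :
    ∃ B : Set (Set (Fin n → ℚ)), IsSteinerSystem m B ∧
      ∀ σ ∈ G, ∀ b ∈ B, (σ : Equiv.Perm (Fin n → ℚ)) '' b ∈ B := by
  have : Nonempty (Fin n) := ⟨⟨0, by omega⟩⟩
  have h : IsJordanLimit G P :=
    { nonempty := by
        have h0 : (0 : Fin n → ℚ) ∈ ⋃ i, P i := hunion ▸ Set.mem_univ _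
        obtain ⟨i, -⟩ := Set.mem_iUnion.1 h0
        exact ⟨i⟩
      exists_gt := hJ
      mono := StrictMono.monotone fun i j hij => hchain i j hij
      exists_notMem := fun i => by
        obtain ⟨j, hij⟩ := hJ i
        obtain ⟨x, -, hx⟩ := Set.exists_of_ssubset (hchain i j hij)
        exact ⟨x, hx⟩
      cover := fun x => Set.mem_iUnion.1 (hunion ▸ Set.mem_univ x)
      move := hmove
      jordan := fun i => (hjordan i).2 }
  cases m with
  | zero =>
    refine absurd (fun f g _ _ => ⟨Equiv.addRight (g 0 - f 0), hsub _ (isAGL_addRight _),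
      fun i => ?_⟩) hnottrans
    rw [Fin.fin_one_eq_zero i]
    simp
  | succ k =>
    obtain ⟨A, c, e, hA, hcA, hc, he⟩ := h.exists_incomparable hn hsub k
    exact h.exists_isSteinerSystem htrans hnottrans fun B x y hB hxB hx =>
      h.exchange htrans hA hcA hc he hB hxB hx
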